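/- Let z be an indeterminate and set Ř(z) to be the 9×9 matrix over ℂ(z) given by the explicit spin-1 entries: acting on ℂ³⊗ℂ³ with basis indexed by pairs (i,j), i,j ∈ {0,1,2}, Ř preserves i+j and on the blocks i+j = 0,4 equals 1; on i+j = 1,3 equals [[2/(z+2), −z/(z+2)],[−z/(z+2), 2/(z+2)]]; on i+j = 2 equals the 3×3 matrix [[2/((z+1)(z+2)), −2z/((z+1)(z+2)), z(z−1)/((z+1)(z+2))], [−2z/((z+1)(z+2)), (z²+z+2)/((z+1)(z+2)), −2z/((z+1)(z+2))], [z(z−1)/((z+1)(z+2)), −2z/((z+1)(z+2)), 2/((z+1)(z+2))]]. Then Ř satisfies the braided Yang–Baxter equation: (Ř(z₂−z₃)⊗1)(1⊗Ř(z₁−z₃))(Ř(z₁−z₂)⊗1) = (1⊗Ř(z₁−z₂))(Ř(z₁−z₃)⊗1)(1⊗Ř(z₂−z₃)) as matrices over ℂ(z₁, z₂, z₃). -/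

import Mathlib

open Matrix

noncomputable section

/-- The field ℂ(z₁, z₂, z₃). -/
abbrev K12 : Type := FractionRing (MvPolynomial (Fin 3) ℂ)

noncomputable def zv (i : Fin 3) : K12 :=
  algebraMap (MvPolynomial (Fin 3) ℂ) K12 (MvPolynomial.X i)

/-- Entry of the spin-1 rational `R`-matrix `Ř(z)` at row `(i,j)`, column `(i',j')`
(indices in `{0,1,2}`, preserving `i+j`). -/
noncomputable def Rent (z : K12) (i j i' j' : ℕ) : K12 :=
  if i + j = i' + j' then
    if i + j = 0 ∨ i + j = 4 then 1
    else if i + j = 1 ∨ i + j = 3 then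
      (if i = i' then 2 / (z + 2) else -z / (z + 2))
    else -- i + j = 2
      (if i = i' then
        (if i = 1 then (z ^ 2 + z + 2) / ((z + 1) * (z + 2))
          else 2 / ((z + 1) * (z + 2)))
      else if (i = 0 ∧ i' = 2) ∨ (i = 2 ∧ i' = 0) then
        z * (z - 1) / ((z + 1) * (z + 2))
      else -2 * z / ((z + 1) * (z + 2)))
  else 0

/-- The spin-1 `R`-matrix acting on ℂ³ ⊗ ℂ³. -/
noncomputable def R12mat (z : K12) :
    Matrix (Fin 3 × Fin 3) (Fin 3 × Fin 3) K12 :=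
  fun p q => Rent z (p.1 : ℕ) (p.2 : ℕ) (q.1 : ℕ) (q.2 : ℕ)

/-- `Ř(z) ⊗ 1` acting on the first two factors of ℂ³ ⊗ ℂ³ ⊗ ℂ³. -/
noncomputable def R12' (z : K12) :
    Matrix (Fin 3 × Fin 3 × Fin 3) (Fin 3 × Fin 3 × Fin 3) K12 :=
  fun p q => R12mat z (p.1, p.2.1) (q.1, q.2.1) * (if p.2.2 = q.2.2 then 1 else 0)

/-- `1 ⊗ Ř(z)` acting on the last two factors of ℂ³ ⊗ ℂ³ ⊗ ℂ³. -/
noncomputable def R23' (z : K12) :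
    Matrix (Fin 3 × Fin 3 × Fin 3) (Fin 3 × Fin 3 × Fin 3) K12 :=
  fun p q => (if p.1 = q.1 then 1 else 0) * R12mat z p.2 q.2

/-- Numerator of the entries of `Ř(z)`, over the common denominator `(z+1)(z+2)`. -/
def numEnt {F : Type*} [CommRing F] (z : F) (i j i' j' : ℕ) : F :=
  if i + j = i' + j' then
    if i + j = 0 ∨ i + j = 4 then (z + 1) * (z + 2)
    else if i + j = 1 ∨ i + j = 3 then
      (if i = i' then 2 * (z + 1) else -z * (z + 1))
    else
      (if i = i' then
        (if i = 1 then z ^ 2 + z + 2 else 2)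
      else if (i = 0 ∧ i' = 2) ∨ (i = 2 ∧ i' = 0) then z * (z - 1)
      else -2 * z)
  else 0

theorem Rent_eq (z : K12) (h1 : z + 1 ≠ 0) (h2 : z + 2 ≠ 0) (i j i' j' : ℕ) :
    Rent z i j i' j' = ((z + 1) * (z + 2))⁻¹ * numEnt z i j i' j' := by
  unfold Rent numEnt
  split_ifs <;> first | (rw [mul_zero]) | field_simp

set_option maxHeartbeats 0 in
theorem num_ybe {F : Type*} [CommRing F] (u v w : F) (hw : w = u + v) (a b c d e f : Fin 3) :
    ∑ x : Fin 3, ∑ y : Fin 3, ∑ t : Fin 3,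
      numEnt u a b x y * numEnt w y c t f * numEnt v x t d e
    = ∑ x : Fin 3, ∑ y : Fin 3, ∑ t : Fin 3,
      numEnt v b c x y * numEnt w a x d t * numEnt u t y e f := by
  subst hw
  by_cases h : (a : ℕ) + b + c = d + e + f
  · simp only [Fin.sum_univ_three]
    fin_cases a <;> fin_cases b <;> fin_cases c <;> fin_cases d <;> fin_cases e <;>
      fin_cases f <;> first | (exfalso; revert h; decide) | (simp [numEnt]; try ring)
  · rw [Finset.sum_eq_zero, Finset.sum_eq_zero]
    all_goals
      intro x _
      refine Finset.sum_eq_zero fun y _ => Finset.sum_eq_zero fun t _ => ?_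
      unfold numEnt
    · by_cases h1 : (b : ℕ) + c = x + y
      · by_cases h2 : (a : ℕ) + x = d + t
        · have h3 : ¬ ((t : ℕ) + y = e + f) := by omega
          rw [if_neg h3, mul_zero]
        · rw [if_neg h2, mul_zero, zero_mul]
      · rw [if_neg h1, zero_mul, zero_mul]
    · by_cases h1 : (a : ℕ) + b = x + y
      · by_cases h2 : (y : ℕ) + c = t + f
        · have h3 : ¬ ((x : ℕ) + t = d + e) := by omega
          rw [if_neg h3, mul_zero]
        · rw [if_neg h2, mul_zero, zero_mul]
      · rw [if_neg h1, zero_mul, zero_mul]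

theorem zv_sub_ne (i j : Fin 3) (c : ℂ) (hc : c ≠ 0) :
    zv i - zv j + algebraMap (MvPolynomial (Fin 3) ℂ) K12 (MvPolynomial.C c) ≠ 0 := by
  unfold zv
  rw [← map_sub, ← map_add]
  intro h
  have h0 := (IsFractionRing.injective (MvPolynomial (Fin 3) ℂ) K12) (h.trans (map_zero _).symm)
  apply hc
  simpa using congrArg (MvPolynomial.eval (fun _ => (0 : ℂ))) h0

theorem zv_sub_one (i j : Fin 3) : zv i - zv j + 1 ≠ 0 := by
  simpa using zv_sub_ne i j 1 one_ne_zero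

theorem zv_sub_two (i j : Fin 3) : zv i - zv j + 2 ≠ 0 := by
  have h := zv_sub_ne i j 2 two_ne_zero
  rwa [map_ofNat MvPolynomial.C 2, map_ofNat (algebraMap (MvPolynomial (Fin 3) ℂ) K12) 2] at h

theorem lhs_entry (u w v : K12) (a b c d e f : Fin 3) :
    (R12' u * R23' w * R12' v) (a, b, c) (d, e, f)
      = ∑ x : Fin 3, ∑ y : Fin 3, ∑ t : Fin 3,
        Rent u a b x y * Rent w y c t f * Rent v x t d e := by
  simp [Matrix.mul_apply, R12', R23', R12mat, Fintype.sum_prod_type]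
  simp only [Finset.sum_mul]
  refine Finset.sum_congr rfl fun x _ => ?_
  rw [Finset.sum_comm]

theorem rhs_entry (u w v : K12) (a b c d e f : Fin 3) :
    (R23' v * R12' w * R23' u) (a, b, c) (d, e, f)
      = ∑ x : Fin 3, ∑ y : Fin 3, ∑ t : Fin 3,
        Rent v b c x y * Rent w a x d t * Rent u t y e f := by
  simp [Matrix.mul_apply, R12', R23', R12mat, Fintype.sum_prod_type]
  simp only [Finset.sum_mul]
  rw [Finset.sum_comm]
  rw [Finset.sum_congr rfl fun y _ => Finset.sum_comm]
  rw [Finset.sum_comm]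

/-- The braided Yang–Baxter equation for the spin-1 rational `R`-matrix. -/
theorem stmt_12 :
    R12' (zv 1 - zv 2) * R23' (zv 0 - zv 2) * R12' (zv 0 - zv 1)
      = R23' (zv 0 - zv 1) * R12' (zv 0 - zv 2) * R23' (zv 1 - zv 2) := by
  ext ⟨a, b, c⟩ ⟨d, e, f⟩
  rw [lhs_entry, rhs_entry]
  have key := num_ybe (zv 1 - zv 2) (zv 0 - zv 1) (zv 0 - zv 2) (by ring) a b c d e f
  have key2 := congrArg (fun s =>
    (((zv 1 - zv 2 + 1) * (zv 1 - zv 2 + 2))⁻¹ * ((zv 0 - zv 2 + 1) * (zv 0 - zv 2 + 2))⁻¹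
      * ((zv 0 - zv 1 + 1) * (zv 0 - zv 1 + 2))⁻¹) * s) key
  simp only [Finset.mul_sum] at key2
  simp only [Rent_eq _ (zv_sub_one _ _) (zv_sub_two _ _)]
  refine Eq.trans ?_ (key2.trans ?_)
  all_goals
    refine Finset.sum_congr rfl fun x _ => Finset.sum_congr rfl fun y _ =>
      Finset.sum_congr rfl fun t _ => ?_
    generalize ((zv 1 - zv 2 + 1) * (zv 1 - zv 2 + 2))⁻¹ = A
    generalize ((zv 0 - zv 2 + 1) * (zv 0 - zv 2 + 2))⁻¹ = B
    generalize ((zv 0 - zv 1 + 1) * (zv 0 - zv 1 + 2))⁻¹ = C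
    ring

end
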